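/- Suppose Assumption A1 holds (for f(y,d) = y − d). Then for every n ≥ 0 there exists a finite nonempty set Γ_n ⊆ ℝ^N such that v_n(x,s) = min_{γ ∈ Γ_n} x·γ for every x ∈ X and every integer s ≤ s*(x). In particular, the map x ↦ v_n(x, s*(x)) is concave and piecewise linear on X. -/

import Mathlib

open Finset

noncomputable section

open scoped Classical

namespace InvCtrl

variable {N M : ℕ} {Z : Type*}

/-- Membership in the belief space `X ⊆ ℝ^N`. -/
def memX (N : ℕ) (x : Fin N → ℝ) : Prop :=
  (∀ i, 0 ≤ x i) ∧ ∑ i, x i = 1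

variable [Fintype Z]

/-- `σ(d_k, z, x) = x ⬝ P(d_k, z) ⬝ 𝟙`. -/
def sigz (P : Fin M → Z → Matrix (Fin N) (Fin N) ℝ) (k : Fin M) (z : Z) (x : Fin N → ℝ) : ℝ :=
  ∑ i, x i * ∑ j, P k z i j

/-- `σ(d_k, x) = ∑_z σ(d_k, z, x)`. -/
def sig (P : Fin M → Z → Matrix (Fin N) (Fin N) ℝ) (k : Fin M) (x : Fin N → ℝ) : ℝ :=
  ∑ z, sigz P k z x

/-- Posterior belief `λ(d_k, z, x) = x P(d_k, z) / σ(d_k, z, x)` (componentwise). -/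
def lam (P : Fin M → Z → Matrix (Fin N) (Fin N) ℝ) (k : Fin M) (z : Z) (x : Fin N → ℝ) :
    Fin N → ℝ :=
  fun j => (∑ i, x i * P k z i j) / sigz P k z x

/-- Single-period cost `c(y, d) = p·(d − y)⁺ + h·(y − d)⁺`. -/
def cst (p hc y dd : ℝ) : ℝ := p * max (dd - y) 0 + hc * max (y - dd) 0

/-- Expected single-period cost `L(x, y) = ∑_k σ(d_k, x) c(y, d_k)`. -/
def Lf (P : Fin M → Z → Matrix (Fin N) (Fin N) ℝ) (d : Fin M → ℤ) (p hc : ℝ)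
    (x : Fin N → ℝ) (y : ℝ) : ℝ :=
  ∑ k, sig P k x * cst p hc y (d k : ℝ)

/-- `s*(x)`: the smallest element of `{d_1, …, d_M}` at which `m ↦ L(x, d_m)` is minimized. -/
def sStar (P : Fin M → Z → Matrix (Fin N) (Fin N) ℝ) (d : Fin M → ℤ) (p hc : ℝ)
    (x : Fin N → ℝ) : ℤ :=
  sInf {t : ℤ | ∃ m : Fin M, t = d m ∧ ∀ k : Fin M, Lf P d p hc x (d m : ℝ) ≤ Lf P d p hc x (d k : ℝ)}

/-- First-order stochastic dominance `x ⪯ x'`. -/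
def sdom (x x' : Fin N → ℝ) : Prop :=
  ∀ n : Fin N, ∑ i ∈ univ.filter (fun i => n ≤ i), x i ≤ ∑ i ∈ univ.filter (fun i => n ≤ i), x' i

/-- The `i`-th standard unit vector in `ℝ^N`. -/
def eV (N : ℕ) (i : Fin N) : Fin N → ℝ := fun j => if j = i then 1 else 0

/-- Assumption A3. -/
def A3 (P : Fin M → Z → Matrix (Fin N) (Fin N) ℝ) : Prop :=
  ∀ i i' : Fin N, i ≤ i' → ∀ m : Fin M,
    ∑ k ∈ univ.filter (fun k : Fin M => m ≤ k), ∑ j, ∑ z, P k z i j ≤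
      ∑ k ∈ univ.filter (fun k : Fin M => m ≤ k), ∑ j, ∑ z, P k z i' j

/-- `A_m(x) = h ∑_{k=1}^m σ(d_k,x) − p ∑_{k=m+1}^M σ(d_k,x)` (for `m = 0, …, M`). -/
def Am (P : Fin M → Z → Matrix (Fin N) (Fin N) ℝ) (p hc : ℝ) (m : ℕ) (x : Fin N → ℝ) : ℝ :=
  hc * ∑ k ∈ univ.filter (fun k : Fin M => (k : ℕ) < m), sig P k x
    - p * ∑ k ∈ univ.filter (fun k : Fin M => m ≤ (k : ℕ)), sig P k x

/-- `B_m(x) = p ∑_{k=m+1}^M d_k σ(d_k,x) − h ∑_{k=1}^m d_k σ(d_k,x)` (for `m = 0, …, M`). -/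
def Bm (P : Fin M → Z → Matrix (Fin N) (Fin N) ℝ) (d : Fin M → ℤ) (p hc : ℝ) (m : ℕ)
    (x : Fin N → ℝ) : ℝ :=
  p * ∑ k ∈ univ.filter (fun k : Fin M => m ≤ (k : ℕ)), (d k : ℝ) * sig P k x
    - hc * ∑ k ∈ univ.filter (fun k : Fin M => (k : ℕ) < m), (d k : ℝ) * sig P k x

/-- Finite-horizon value iteration: `v_0 = 0` and
`v_{n+1}(x,s) = inf_{y ≥ s, y ∈ ℤ} [ L(x,y) + β ∑_{(d_k,z) : σ(d_k,z,x) ≠ 0} σ(d_k,z,x)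
v_n(λ(d_k,z,x), f(y,d_k)) ]`, for a general transition `f` of the inventory position. -/
def vIter (P : Fin M → Z → Matrix (Fin N) (Fin N) ℝ) (d : Fin M → ℤ) (p hc β : ℝ)
    (f : ℤ → ℤ → ℤ) : ℕ → (Fin N → ℝ) → ℤ → ℝ
  | 0, _, _ => 0
  | n + 1, x, s =>
    sInf {r : ℝ | ∃ y : ℤ, s ≤ y ∧
      r = Lf P d p hc x (y : ℝ) + β * ∑ k, ∑ z,
        (if sigz P k z x = 0 then 0
         else sigz P k z x * vIter P d p hc β f n (lam P k z x) (f y (d k)))}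

theorem sigz_nonneg' (P : Fin M → Z → Matrix (Fin N) (Fin N) ℝ)
    (hPnn : ∀ k z i j, 0 ≤ P k z i j) (k : Fin M) (z : Z) (x : Fin N → ℝ)
    (hx : memX N x) : 0 ≤ sigz P k z x :=
  Finset.sum_nonneg fun i _ => mul_nonneg (hx.1 i) (Finset.sum_nonneg fun j _ => hPnn k z i j)

theorem sigz_eq' (P : Fin M → Z → Matrix (Fin N) (Fin N) ℝ) (k : Fin M) (z : Z)
    (x : Fin N → ℝ) : sigz P k z x = ∑ j, ∑ i, x i * P k z i j := by
  unfold sigz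
  rw [Finset.sum_comm]
  simp only [Finset.mul_sum]

theorem sigz_mul_lam (P : Fin M → Z → Matrix (Fin N) (Fin N) ℝ)
    (hPnn : ∀ k z i j, 0 ≤ P k z i j) (k : Fin M) (z : Z) (x : Fin N → ℝ)
    (hx : memX N x) (j : Fin N) :
    ∑ i, x i * P k z i j = sigz P k z x * lam P k z x j := by
  unfold lam
  by_cases h : sigz P k z x = 0
  · rw [h, zero_mul]
    rw [sigz_eq'] at h
    exact (Finset.sum_eq_zero_iff_of_nonneg (fun j _ => Finset.sum_nonneg
      fun i _ => mul_nonneg (hx.1 i) (hPnn k z i j))).1 h j (Finset.mem_univ j)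
  · field_simp

theorem lam_mem (P : Fin M → Z → Matrix (Fin N) (Fin N) ℝ)
    (hPnn : ∀ k z i j, 0 ≤ P k z i j) (k : Fin M) (z : Z) (x : Fin N → ℝ)
    (hx : memX N x) (h : sigz P k z x ≠ 0) : memX N (lam P k z x) := by
  constructor
  · intro j
    exact div_nonneg (Finset.sum_nonneg fun i _ => mul_nonneg (hx.1 i) (hPnn k z i j))
      (sigz_nonneg' P hPnn k z x hx)
  · unfold lam
    rw [← Finset.sum_div, ← sigz_eq', div_self h]

theorem sig_nonneg' (P : Fin M → Z → Matrix (Fin N) (Fin N) ℝ)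
    (hPnn : ∀ k z i j, 0 ≤ P k z i j) (k : Fin M) (x : Fin N → ℝ)
    (hx : memX N x) : 0 ≤ sig P k x :=
  Finset.sum_nonneg fun z _ => sigz_nonneg' P hPnn k z x hx

theorem cst_nonneg' (p hc : ℝ) (hp : 0 < p) (hhc : 0 < hc) (y dd : ℝ) : 0 ≤ cst p hc y dd := by
  unfold cst; positivity

theorem cst_ge (p hc : ℝ) (hp : 0 < p) {a y dd : ℝ} (h1 : y ≤ a) (h2 : a ≤ dd) :
    cst p hc a dd ≤ cst p hc y dd := by
  unfold cst
  rw [max_eq_left (by linarith), max_eq_right (by linarith), max_eq_left (by linarith),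
    max_eq_right (by linarith)]
  nlinarith

theorem cst_le (p hc : ℝ) (hhc : 0 < hc) {a y dd : ℝ} (h1 : a ≤ y) (h2 : dd ≤ a) :
    cst p hc a dd ≤ cst p hc y dd := by
  unfold cst
  rw [max_eq_right (by linarith), max_eq_left (by linarith), max_eq_right (by linarith),
    max_eq_left (by linarith)]
  nlinarith

theorem cst_affine (p hc : ℝ) {a b y dd : ℝ} (h1 : a ≤ y) (h2 : y ≤ b)
    (h : dd ≤ a ∨ b ≤ dd) :
    (b - a) * cst p hc y dd = (b - y) * cst p hc a dd + (y - a) * cst p hc b dd := by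
  unfold cst
  rcases h with h | h
  · rw [max_eq_right (by linarith), max_eq_left (by linarith), max_eq_right (by linarith),
      max_eq_left (by linarith), max_eq_right (by linarith), max_eq_left (by linarith)]
    ring
  · rw [max_eq_left (by linarith), max_eq_right (by linarith), max_eq_left (by linarith),
      max_eq_right (by linarith), max_eq_left (by linarith), max_eq_right (by linarith)]
    ring

theorem Lf_min (hM : 1 ≤ M) (P : Fin M → Z → Matrix (Fin N) (Fin N) ℝ)
    (hPnn : ∀ k z i j, 0 ≤ P k z i j) (d : Fin M → ℤ) (p hc : ℝ) (hp : 0 < p) (hhc : 0 < hc)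
    (x : Fin N → ℝ) (hx : memX N x) (μ : ℝ)
    (hμ : ∀ k, μ ≤ Lf P d p hc x (d k : ℝ)) (y : ℝ) : μ ≤ Lf P d p hc x y := by
  have hW := fun k => sig_nonneg' P hPnn k x hx
  by_cases hA : (univ.filter fun k : Fin M => (d k : ℝ) ≤ y).Nonempty
  · obtain ⟨a, ha, hamax⟩ := Finset.exists_max_image _ d hA
    simp only [Finset.mem_filter, Finset.mem_univ, true_and] at ha hamax
    by_cases hB : (univ.filter fun k : Fin M => y < (d k : ℝ)).Nonempty
    · obtain ⟨b, hb, hbmin⟩ := Finset.exists_min_image _ d hB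
      simp only [Finset.mem_filter, Finset.mem_univ, true_and] at hb hbmin
      have key : ((d b : ℝ) - d a) * Lf P d p hc x y
          = (d b - y) * Lf P d p hc x (d a) + (y - d a) * Lf P d p hc x (d b) := by
        unfold Lf
        rw [Finset.mul_sum, Finset.mul_sum, Finset.mul_sum, ← Finset.sum_add_distrib]
        refine Finset.sum_congr rfl fun k _ => ?_
        have := cst_affine p hc (dd := (d k : ℝ)) ha hb.le (by
          rcases le_or_gt (d k : ℝ) y with h | h
          · left; exact_mod_cast hamax k h
          · right; exact_mod_cast hbmin k h)
        linear_combination sig P k x * this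
      have h1 := mul_le_mul_of_nonneg_left (hμ a) (sub_nonneg.2 hb.le)
      have h2 := mul_le_mul_of_nonneg_left (hμ b) (sub_nonneg.2 ha)
      have h3 : (0 : ℝ) < d b - d a := by linarith
      refine le_of_mul_le_mul_left ?_ h3
      rw [key]; linarith
    · refine (hμ a).trans (Finset.sum_le_sum fun k _ => mul_le_mul_of_nonneg_left ?_ (hW k))
      refine cst_le p hc hhc ha ?_
      have : (d k : ℝ) ≤ y := by
        by_contra h
        exact hB ⟨k, by simpa using h⟩
      exact_mod_cast hamax k this
  · obtain ⟨a, -, hamin⟩ := Finset.exists_min_image (univ : Finset (Fin M)) d ⟨⟨0, hM⟩, by simp⟩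
    refine (hμ a).trans (Finset.sum_le_sum fun k _ => mul_le_mul_of_nonneg_left ?_ (hW k))
    refine cst_ge p hc hp ?_ (by exact_mod_cast hamin k (by simp))
    by_contra h
    exact hA ⟨a, by simpa using (not_le.1 h).le⟩

theorem sStar_spec (hM : 1 ≤ M) (P : Fin M → Z → Matrix (Fin N) (Fin N) ℝ)
    (d : Fin M → ℤ) (p hc : ℝ) (x : Fin N → ℝ) :
    ∃ m, sStar P d p hc x = d m ∧ ∀ k, Lf P d p hc x (d m : ℝ) ≤ Lf P d p hc x (d k : ℝ) := by
  refine Int.csInf_mem (s := {t : ℤ | ∃ m : Fin M, t = d m ∧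
    ∀ k : Fin M, Lf P d p hc x (d m : ℝ) ≤ Lf P d p hc x (d k : ℝ)}) ?_ ?_
  · obtain ⟨a, -, ha⟩ := Finset.exists_min_image (univ : Finset (Fin M))
      (fun k => Lf P d p hc x (d k : ℝ)) ⟨⟨0, hM⟩, by simp⟩
    exact ⟨d a, a, rfl, fun k => ha k (by simp)⟩
  · refine ((Set.finite_range d).subset ?_).bddBelow
    rintro t ⟨m, rfl, -⟩
    exact ⟨m, rfl⟩

/-- The bracket of the Bellman operator. -/
def bracket (P : Fin M → Z → Matrix (Fin N) (Fin N) ℝ) (d : Fin M → ℤ) (p hc β : ℝ)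
    (n : ℕ) (x : Fin N → ℝ) (y : ℤ) : ℝ :=
  Lf P d p hc x (y : ℝ) + β * ∑ k, ∑ z,
        (if sigz P k z x = 0 then 0
         else sigz P k z x * vIter P d p hc β (fun y dd => y - dd) n (lam P k z x) (y - d k))

theorem vIter_succ' (P : Fin M → Z → Matrix (Fin N) (Fin N) ℝ) (d : Fin M → ℤ) (p hc β : ℝ)
    (n : ℕ) (x : Fin N → ℝ) (s : ℤ) :
    vIter P d p hc β (fun y dd => y - dd) (n + 1) x s =
      sInf {r : ℝ | ∃ y : ℤ, s ≤ y ∧ r = bracket P d p hc β n x y} := rfl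

theorem vIter_nonneg' (P : Fin M → Z → Matrix (Fin N) (Fin N) ℝ)
    (hPnn : ∀ k z i j, 0 ≤ P k z i j) (d : Fin M → ℤ) (p hc β : ℝ) (hp : 0 < p) (hhc : 0 < hc)
    (hβ0 : 0 ≤ β) (n : ℕ) : ∀ (x : Fin N → ℝ), memX N x → 
      (∀ s, 0 ≤ vIter P d p hc β (fun y dd => y - dd) n x s) ∧
      (∀ y, 0 ≤ bracket P d p hc β n x y) := by
  have step : ∀ n, (∀ (x : Fin N → ℝ), memX N x → 
      (∀ s, 0 ≤ vIter P d p hc β (fun y dd => y - dd) n x s)) → 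
      ∀ (x : Fin N → ℝ), memX N x → (∀ y, 0 ≤ bracket P d p hc β n x y) := by
    intro n ih x hx y
    refine add_nonneg (Finset.sum_nonneg fun k _ => mul_nonneg (sig_nonneg' P hPnn k x hx)
      (cst_nonneg' p hc hp hhc _ _)) (mul_nonneg hβ0 (Finset.sum_nonneg fun k _ =>
        Finset.sum_nonneg fun z _ => ?_))
    split_ifs with h
    · exact le_rfl
    · exact mul_nonneg (sigz_nonneg' P hPnn k z x hx) (ih _ (lam_mem P hPnn k z x hx h) _)
  have main : ∀ (x : Fin N → ℝ), memX N x → 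
      (∀ s, 0 ≤ vIter P d p hc β (fun y dd => y - dd) n x s) := by
    induction n with
    | zero => intro x _ s; exact le_rfl
    | succ n ih =>
      intro x hx s
      rw [vIter_succ']
      refine Real.sInf_nonneg ?_
      rintro r ⟨y, -, rfl⟩
      exact step n ih x hx y
  exact fun x hx => ⟨main x hx, step n main x hx⟩

theorem vIter_mono' (P : Fin M → Z → Matrix (Fin N) (Fin N) ℝ)
    (hPnn : ∀ k z i j, 0 ≤ P k z i j) (d : Fin M → ℤ) (p hc β : ℝ) (hp : 0 < p) (hhc : 0 < hc)
    (hβ0 : 0 ≤ β) (n : ℕ) (x : Fin N → ℝ) (hx : memX N x) {s t : ℤ} (hst : s ≤ t) :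
    vIter P d p hc β (fun y dd => y - dd) n x s ≤ vIter P d p hc β (fun y dd => y - dd) n x t := by
  cases n with
  | zero => exact le_rfl
  | succ n =>
    rw [vIter_succ', vIter_succ']
    refine csInf_le_csInf ⟨0, ?_⟩ ⟨_, t, le_rfl, rfl⟩ ?_
    · rintro r ⟨y, -, rfl⟩
      exact (vIter_nonneg' P hPnn d p hc β hp hhc hβ0 n x hx).2 y
    · rintro r ⟨y, hy, rfl⟩
      exact ⟨y, hst.trans hy, rfl⟩

/-- the vectors of the next generation -/
def nextVec (P : Fin M → Z → Matrix (Fin N) (Fin N) ℝ) (d : Fin M → ℤ) (p hc β : ℝ)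
    (m : Fin M) (g : Fin M → Z → Fin N → ℝ) : Fin N → ℝ :=
  fun i => ∑ k, (∑ z, ∑ j, P k z i j) * cst p hc (d m : ℝ) (d k : ℝ)
    + β * ∑ k, ∑ z, ∑ j, P k z i j * g k z j

theorem nextVec_dot (P : Fin M → Z → Matrix (Fin N) (Fin N) ℝ)
    (hPnn : ∀ k z i j, 0 ≤ P k z i j) (d : Fin M → ℤ) (p hc β : ℝ)
    (m : Fin M) (g : Fin M → Z → Fin N → ℝ) (x : Fin N → ℝ) (hx : memX N x) :
    ∑ i, x i * nextVec P d p hc β m g i = Lf P d p hc x (d m : ℝ) + β * ∑ k, ∑ z,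
        sigz P k z x * ∑ j, lam P k z x j * g k z j := by
  unfold nextVec
  simp only [mul_add, Finset.sum_add_distrib]
  congr 1
  · unfold Lf sig sigz
    simp only [Finset.mul_sum, Finset.sum_mul]
    rw [Finset.sum_comm]
    refine Finset.sum_congr rfl fun k _ => ?_
    rw [Finset.sum_comm]
    refine Finset.sum_congr rfl fun z _ => ?_
    refine Finset.sum_congr rfl fun i _ => ?_
    refine Finset.sum_congr rfl fun j _ => ?_
    ring
  · have : ∀ k z, sigz P k z x * ∑ j, lam P k z x j * g k z j
        = ∑ i, ∑ j, x i * (P k z i j * g k z j) := by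
      intro k z
      rw [Finset.sum_comm, Finset.mul_sum]
      refine Finset.sum_congr rfl fun j _ => ?_
      rw [← mul_assoc, ← sigz_mul_lam P hPnn k z x hx j, Finset.sum_mul]
      exact Finset.sum_congr rfl fun i _ => by ring
    simp only [this]
    simp only [Finset.mul_sum]
    rw [Finset.sum_comm]
    refine Finset.sum_congr rfl fun k _ => ?_
    rw [Finset.sum_comm]
    refine Finset.sum_congr rfl fun z _ => ?_
    refine Finset.sum_congr rfl fun i _ => ?_
    refine Finset.sum_congr rfl fun j _ => ?_
    ring

theorem repr_exists (hM : 1 ≤ M)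
    (d : Fin M → ℤ)
    (P : Fin M → Z → Matrix (Fin N) (Fin N) ℝ)
    (hPnn : ∀ k z i j, 0 ≤ P k z i j)
    (p hc : ℝ) (hp : 0 < p) (hhc : 0 < hc)
    (β : ℝ) (hβ0 : 0 ≤ β)
    (hA1 : ∀ x : Fin N → ℝ, memX N x → ∀ (k : Fin M) (z : Z), sigz P k z x ≠ 0 →
      sStar P d p hc x - d k ≤ sStar P d p hc (lam P k z x)) (n : ℕ) :
    ∃ (Γ : Finset (Fin N → ℝ)) (hΓ : Γ.Nonempty),
      (∀ x : Fin N → ℝ, memX N x → ∀ s : ℤ, s ≤ sStar P d p hc x →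
        vIter P d p hc β (fun y dd => y - dd) n x s =
          Γ.inf' hΓ (fun γ => ∑ i, x i * γ i)) := by
  induction n with
  | zero =>
    refine ⟨{0}, by simp, ?_⟩
    intro x _ s _
    simp [vIter]
  | succ n ih =>
    obtain ⟨Γ, hΓ, ih⟩ := ih
    obtain ⟨γ0, hγ0⟩ := hΓ
    have hne : ((univ : Finset (Fin M × (Fin M → Z → Γ))).image
        (fun q => nextVec P d p hc β q.1 (fun k z => (q.2 k z : Fin N → ℝ)))).Nonempty :=
      ⟨_, Finset.mem_image_of_mem _ (Finset.mem_univ (⟨0, hM⟩, fun _ _ => ⟨γ0, hγ0⟩))⟩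
    refine ⟨_, hne, ?_⟩
    intro x hx s hs
    obtain ⟨m, hm, hmin⟩ := sStar_spec hM P d p hc x
    -- the infimum is attained at the myopic level
    have hv : vIter P d p hc β (fun y dd => y - dd) (n + 1) x s
        = bracket P d p hc β n x (d m) := by
      rw [vIter_succ']
      refine IsLeast.csInf_eq ⟨⟨d m, hm ▸ hs, rfl⟩, ?_⟩
      rintro r ⟨y, -, rfl⟩
      unfold bracket
      refine add_le_add (Lf_min hM P hPnn d p hc hp hhc x hx _ hmin _)
        (mul_le_mul_of_nonneg_left (Finset.sum_le_sum fun k _ =>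
          Finset.sum_le_sum fun z _ => ?_) hβ0)
      split_ifs with h
      · exact le_rfl
      · refine mul_le_mul_of_nonneg_left ?_ (sigz_nonneg' P hPnn k z x hx)
        have hl := lam_mem P hPnn k z x hx h
        have hA := hA1 x hx k z h
        rcases le_total (d m) y with hy | hy
        · exact vIter_mono' P hPnn d p hc β hp hhc hβ0 n _ hl (by omega)
        · rw [ih _ hl _ (by omega), ih _ hl _ (by omega)]
    rw [hv]
    have hterm : ∀ k z, sigz P k z x ≠ 0 →
        vIter P d p hc β (fun y dd => y - dd) n (lam P k z x) (d m - d k) =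
          Γ.inf' ⟨γ0, hγ0⟩ (fun γ => ∑ i, lam P k z x i * γ i) := by
      intro k z h
      exact ih _ (lam_mem P hPnn k z x hx h) _ (hm ▸ hA1 x hx k z h)
    apply le_antisymm
    · refine Finset.le_inf' _ _ ?_
      intro γ hγ
      obtain ⟨⟨m', g⟩, -, rfl⟩ := Finset.mem_image.1 hγ
      simp only
      rw [nextVec_dot P hPnn d p hc β _ _ x hx]
      unfold bracket
      refine add_le_add (hmin m')
        (mul_le_mul_of_nonneg_left (Finset.sum_le_sum fun k _ =>
          Finset.sum_le_sum fun z _ => ?_) hβ0)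
      split_ifs with h
      · rw [h, zero_mul]
      · refine mul_le_mul_of_nonneg_left ?_ (sigz_nonneg' P hPnn k z x hx)
        rw [hterm k z h]
        exact Finset.inf'_le (fun γ => ∑ i, lam P k z x i * γ i) (g k z).2
    · have hch : ∀ k z, ∃ γ : Γ, Γ.inf' ⟨γ0, hγ0⟩ (fun γ => ∑ i, lam P k z x i * γ i)
          = ∑ i, lam P k z x i * (γ : Fin N → ℝ) i := by
        intro k z
        obtain ⟨γ, h1, h2⟩ := Finset.exists_mem_eq_inf' ⟨γ0, hγ0⟩
          (fun γ : Fin N → ℝ => ∑ i, lam P k z x i * γ i)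
        exact ⟨⟨γ, h1⟩, h2⟩
      choose g hg using hch
      refine (Finset.inf'_le _ (Finset.mem_image_of_mem _ (Finset.mem_univ (m, g)))).trans ?_
      simp only
      rw [nextVec_dot P hPnn d p hc β _ _ x hx]
      unfold bracket
      refine le_of_eq ?_
      congr 2
      refine Finset.sum_congr rfl fun k _ => Finset.sum_congr rfl fun z _ => ?_
      split_ifs with h
      · rw [h, zero_mul]
      · rw [hterm k z h, hg k z]

/-- under Assumption A1 (for `f(y,d) = y − d`), each `v_n` admits a
finite vector representation `v_n(x,s) = min_{γ ∈ Γ_n} x·γ` for `s ≤ s*(x)`; in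
particular `x ↦ v_n(x, s*(x))` is concave (and piecewise linear) on `X`. -/
theorem stmt8 {N M : ℕ} {Z : Type*} [Fintype Z] [Nonempty Z]
    (hN : 1 ≤ N) (hM : 1 ≤ M)
    (d : Fin M → ℤ) (hd : StrictMono d)
    (P : Fin M → Z → Matrix (Fin N) (Fin N) ℝ)
    (hPnn : ∀ k z i j, 0 ≤ P k z i j)
    (hPst : ∀ i : Fin N, ∑ k : Fin M, ∑ z : Z, ∑ j : Fin N, P k z i j = 1)
    (p hc : ℝ) (hp : 0 < p) (hhc : 0 < hc)
    (β : ℝ) (hβ0 : 0 ≤ β) (hβ1 : β < 1)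
    (hA1 : ∀ x : Fin N → ℝ, memX N x → ∀ (k : Fin M) (z : Z), sigz P k z x ≠ 0 →
      sStar P d p hc x - d k ≤ sStar P d p hc (lam P k z x)) :
    ∀ n : ℕ, ∃ (Γ : Finset (Fin N → ℝ)) (hΓ : Γ.Nonempty),
      (∀ x : Fin N → ℝ, memX N x → ∀ s : ℤ, s ≤ sStar P d p hc x →
        vIter P d p hc β (fun y dd => y - dd) n x s =
          Γ.inf' hΓ (fun γ => ∑ i, x i * γ i)) ∧
      (∀ x x' : Fin N → ℝ, memX N x → memX N x' → ∀ a b : ℝ, 0 ≤ a → 0 ≤ b → a + b = 1 →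
        a * vIter P d p hc β (fun y dd => y - dd) n x (sStar P d p hc x) +
            b * vIter P d p hc β (fun y dd => y - dd) n x' (sStar P d p hc x') ≤
          vIter P d p hc β (fun y dd => y - dd) n (fun i => a * x i + b * x' i)
            (sStar P d p hc (fun i => a * x i + b * x' i))) := by
  intro n
  obtain ⟨Γ, hΓ, h⟩ := repr_exists hM d P hPnn p hc hp hhc β hβ0 hA1 n
  refine ⟨Γ, hΓ, h, ?_⟩
  intro x x' hx hx' a b ha hb hab
  have hmem : memX N (fun i => a * x i + b * x' i) := by
    constructor
    · intro i
      exact add_nonneg (mul_nonneg ha (hx.1 i)) (mul_nonneg hb (hx'.1 i))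
    · rw [Finset.sum_add_distrib, ← Finset.mul_sum, ← Finset.mul_sum, hx.2, hx'.2]
      linarith
  rw [h x hx _ le_rfl, h x' hx' _ le_rfl, h _ hmem _ le_rfl]
  refine Finset.le_inf' _ _ fun γ hγ => ?_
  have h1 := mul_le_mul_of_nonneg_left
    (Finset.inf'_le (fun γ : Fin N → ℝ => ∑ i, x i * γ i) hγ) ha
  have h2 := mul_le_mul_of_nonneg_left
    (Finset.inf'_le (fun γ : Fin N → ℝ => ∑ i, x' i * γ i) hγ) hb
  refine (add_le_add h1 h2).trans (le_of_eq ?_)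
  simp only [Finset.mul_sum, ← Finset.sum_add_distrib]
  exact Finset.sum_congr rfl fun i _ => by ring

end InvCtrl
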